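/- arXiv:q-alg/9707028 — 3 statements merged into one kernel-verified Lean document; each statement's English description precedes it below -/
import Mathlib

section
/- Vanishing Theorem, part 1: Let n ≥ 1 and let λ and ρ be partitions with at most n parts such that λ is not contained in ρ. Then s_λ(a_ρ|a) = 0, as an identity in the polynomial ring ℤ[a_i : i ∈ ℤ]. -/
open scoped BigOperators

namespace FactorialLR

/-- A filling of the cell set `s` with entries in `Fin n` (`0`-based, representing the
`1`-based entries `{1,…,n}`) is semistandard if it weakly increases along rows and strictly
increases down columns. -/
def IsSsyt {n : ℕ} (s : Finset (ℕ × ℕ)) (T : s → Fin n) : Prop :=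
  (∀ c c' : s, (c : ℕ × ℕ).1 = (c' : ℕ × ℕ).1 → (c : ℕ × ℕ).2 ≤ (c' : ℕ × ℕ).2 → T c ≤ T c') ∧
  (∀ c c' : s, (c : ℕ × ℕ).1 < (c' : ℕ × ℕ).1 → (c : ℕ × ℕ).2 = (c' : ℕ × ℕ).2 → T c < T c')

/-- The factorial Schur-type polynomial attached to a (possibly skew) cell set `s`:
`Σ_T ∏_{α ∈ s} (x_{T(α)} − a_{T(α)+c(α)})`, where `T` runs over semistandard fillings of `s`
with entries in `{1,…,n}` (stored `0`-based) and `c(α) = j − i` is the content of `α = (i,j)`.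
Taking `a = 0` gives the ordinary Schur polynomial. -/
noncomputable def sgen {A : Type} [CommRing A] (n : ℕ) (s : Finset (ℕ × ℕ))
    (x : Fin n → A) (a : ℤ → A) : A :=
  ∑ᶠ T ∈ {T : s → Fin n | IsSsyt s T},
    ∏ c : s, (x (T c) - a ((T c : ℤ) + 1 + ((c : ℕ × ℕ).2 : ℤ) - ((c : ℕ × ℕ).1 : ℤ)))

/-- The `n`-tuple `a_ρ = (a_{ρ_1+n}, a_{ρ_2+n-1}, …, a_{ρ_n+1})`; the `i`-th entry
(`0`-based `i`) is `a_{ρ_{i+1}+n-(i+1)+1}`. -/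
noncomputable def subA {A : Type} [CommRing A] (n : ℕ) (a : ℤ → A) (ρ : YoungDiagram) :
    Fin n → A :=
  fun i => a ((ρ.rowLen i : ℤ) + (n : ℤ) - (i : ℤ))

section Aux

variable {A : Type} [CommRing A]

/-- Complete factorial sum in two variables. -/
def mid (b : ℕ → A) (x y : A) (u v : ℕ) : A :=
  ∑ m ∈ Finset.Icc u v, (∏ j ∈ Finset.Ico u m, (x - b j)) * ∏ j ∈ Finset.Ico m v, (y - b (j + 1))

lemma mid_succ (b : ℕ → A) (x y : A) (u v : ℕ) (h : u ≤ v) :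
    mid b x y u (v + 1) = mid b x y u v * (y - b (v + 1)) + ∏ j ∈ Finset.Ico u (v + 1), (x - b j) := by
  unfold mid
  rw [Finset.sum_Icc_succ_top (by omega), Finset.sum_mul]
  congr 1
  · apply Finset.sum_congr rfl
    intro m hm
    rw [Finset.mem_Icc] at hm
    rw [Finset.prod_Ico_succ_top hm.2, mul_assoc]
  · simp

lemma mid_tel (b : ℕ → A) (x y : A) (u v : ℕ) (h : u ≤ v) :
    (x - y) * mid b x y u v =
      ∏ j ∈ Finset.Ico u (v + 1), (x - b j) - ∏ j ∈ Finset.Ico u (v + 1), (y - b j) := by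
  induction v, h using Nat.le_induction with
  | base => simp [mid]
  | succ v h ih =>
    rw [mid_succ b x y u v h, Finset.prod_Ico_succ_top (by omega : u ≤ v + 1),
      Finset.prod_Ico_succ_top (by omega : u ≤ v + 1)]
    linear_combination (y - b (v + 1)) * ih

lemma mid_symm (b : ℕ → A) (x y : A) (u v : ℕ) : mid b x y u v = mid b y x u v := by
  rcases Nat.lt_or_ge v u with h | h
  · simp [mid, Finset.Icc_eq_empty_of_lt h]
  · induction v, h using Nat.le_induction with
    | base => simp [mid]
    | succ v h ih =>
      rw [mid_succ b x y u v h, mid_succ b y x u v h, ← ih]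
      linear_combination - mid_tel b x y u v h

/-- Extension of a tuple by zero. -/
def ext {N : ℕ} (ν : Fin N → ℕ) (i : ℕ) : ℕ := if h : i < N then ν ⟨i, h⟩ else 0

/-- Tuples interlacing with `ν`. -/
def inter {N : ℕ} (ν : Fin N → ℕ) : Finset (Fin N → ℕ) :=
  Fintype.piFinset fun i => Finset.Icc (ext ν (i + 1)) (ν i)

/-- Weight of a horizontal strip. -/
def wt {N : ℕ} (a : ℤ → A) (k : ℕ) (x : A) (ν κ : Fin N → ℕ) : A :=
  ∏ i, ∏ j ∈ Finset.Ico (κ i) (ν i), (x - a ((k : ℤ) + 1 + (j : ℤ) - ((i : ℕ) : ℤ)))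

/-- lower bound -/
def lowB {M : ℕ} (ν μ : Fin (M + 1) → ℕ) (i : Fin (M + 1)) : ℕ := max (μ i) (ext ν (i + 1))

/-- upper bound -/
def uppB {M : ℕ} (ν μ : Fin (M + 1) → ℕ) (i : Fin (M + 1)) : ℕ :=
  min (ν i) ((Fin.cons (ν 0) (fun j : Fin M => μ j.castSucc) : Fin (M + 1) → ℕ) i)

lemma ext_fin {N : ℕ} (ν : Fin N → ℕ) (i : Fin N) : ext ν i = ν i := by simp [ext]

lemma ext_succ {M : ℕ} (ν : Fin (M + 1) → ℕ) (i : Fin M) :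
    ext ν ((i : ℕ) + 1) = ν i.succ := by
  have := ext_fin ν i.succ
  simpa using this

lemma ext_last {M : ℕ} (ν : Fin (M + 1) → ℕ) : ext ν (M + 1) = 0 := by simp [ext]

lemma mem_iff {M : ℕ} (ν κ μ : Fin (M + 1) → ℕ) :
    (κ ∈ inter ν ∧ μ ∈ inter κ) ↔
      (κ ∈ Fintype.piFinset (fun i => Finset.Icc (lowB ν μ i) (uppB ν μ i)) ∧
        μ ∈ Fintype.piFinset (fun i => Finset.range (ν i + 1))) := by
  simp only [inter, Fintype.mem_piFinset, Finset.mem_Icc, Finset.mem_range, lowB, uppB, max_le_iff,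
    le_min_iff]
  constructor
  · rintro ⟨h1, h2⟩
    refine ⟨fun i => ⟨⟨(h2 i).2, (h1 i).1⟩, (h1 i).2, ?_⟩, fun i => ?_⟩
    · refine Fin.cases ?_ (fun j => ?_) i
      · simpa using (h1 0).2
      · have := (h2 j.castSucc).1
        simp only [Fin.val_castSucc, ext_succ] at this
        simpa using this
    · have := (h1 i).2
      have := (h2 i).2
      omega
  · rintro ⟨h1, h2⟩
    refine ⟨fun i => ⟨(h1 i).1.2, (h1 i).2.1⟩, fun i => ⟨?_, (h1 i).1.1⟩⟩
    refine Fin.lastCases ?_ (fun j => ?_) i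
    · simp [ext_last]
    · have := (h1 j.succ).2.2
      simp only [Fin.val_castSucc, ext_succ]
      simpa using this

lemma left_eq {M : ℕ} (a : ℤ → A) (k : ℕ) (x : A) (ν μ : Fin (M + 1) → ℕ) :
    (∏ i, ∏ j ∈ Finset.Ico (μ i) (lowB ν μ i), (x - a ((k : ℤ) + 1 + (j : ℤ) - ((i : ℕ) : ℤ)))) =
    ∏ i, ∏ j ∈ Finset.Ico (uppB ν μ i) (ν i),
      (x - a ((k : ℤ) + 1 + ((j + 1 : ℕ) : ℤ) - ((i : ℕ) : ℤ))) := by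
  rw [Fin.prod_univ_castSucc, Fin.prod_univ_succ]
  have e1 : Finset.Ico (μ (Fin.last M)) (lowB ν μ (Fin.last M)) = ∅ := by
    simp [lowB, ext_last]
  have e2 : Finset.Ico (uppB ν μ 0) (ν 0) = ∅ := by
    simp [uppB]
  rw [e1, e2]
  simp only [Finset.prod_empty, mul_one, one_mul]
  apply Finset.prod_congr rfl
  intro i _
  have e3 : Finset.Ico (μ i.castSucc) (lowB ν μ i.castSucc) =
      Finset.Ico (uppB ν μ i.succ) (ν i.succ) := by
    ext j
    simp only [lowB, uppB, Fin.val_castSucc, ext_succ, Fin.cons_succ, Finset.mem_Ico]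
    omega
  rw [e3]
  apply Finset.prod_congr rfl
  intro j _
  congr 2
  simp only [Fin.val_castSucc, Fin.val_succ]
  push_cast
  ring

lemma inner_eq {M : ℕ} (a : ℤ → A) (k : ℕ) (x y : A) (ν μ : Fin (M + 1) → ℕ)
    (hμ : ∀ i, μ i ≤ ν i) :
    ∑ κ ∈ Fintype.piFinset (fun i => Finset.Icc (lowB ν μ i) (uppB ν μ i)),
      wt a k x κ μ * wt a (k + 1) y ν κ =
    (∏ i, ∏ j ∈ Finset.Ico (μ i) (lowB ν μ i), (x - a ((k : ℤ) + 1 + (j : ℤ) - ((i : ℕ) : ℤ)))) *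
    (∏ i, ∏ j ∈ Finset.Ico (uppB ν μ i) (ν i),
      (y - a ((k : ℤ) + 1 + ((j + 1 : ℕ) : ℤ) - ((i : ℕ) : ℤ)))) *
    ∏ i : Fin (M + 1), mid (fun j => a ((k : ℤ) + 1 + (j : ℤ) - ((i : ℕ) : ℤ))) x y
      (lowB ν μ i) (uppB ν μ i) := by
  unfold mid
  rw [Finset.prod_univ_sum, Finset.mul_sum]
  apply Finset.sum_congr rfl
  intro κ hκ
  simp only [Fintype.mem_piFinset, Finset.mem_Icc] at hκ
  unfold wt
  rw [← Finset.prod_mul_distrib, ← Finset.prod_mul_distrib, ← Finset.prod_mul_distrib]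
  apply Finset.prod_congr rfl
  intro i _
  have h1 : μ i ≤ lowB ν μ i := le_max_left _ _
  have h2 : uppB ν μ i ≤ ν i := min_le_left _ _
  rw [← Finset.prod_Ico_consecutive _ h1 (hκ i).1, ← Finset.prod_Ico_consecutive _ (hκ i).2 h2]
  have e : ∀ j : ℕ, (((k + 1 : ℕ) : ℤ) + 1 + (j : ℤ) - ((i : ℕ) : ℤ)) =
      ((k : ℤ) + 1 + ((j + 1 : ℕ) : ℤ) - ((i : ℕ) : ℤ)) := by
    intro j; push_cast; ring
  simp only [e]
  ring

lemma top_expand {M : ℕ} (a : ℤ → A) (k : ℕ) (x y : A) (ν : Fin (M + 1) → ℕ)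
    (G : (Fin (M + 1) → ℕ) → A) :
    ∑ κ ∈ inter ν, (∑ μ ∈ inter κ, G μ * wt a k x κ μ) * wt a (k + 1) y ν κ =
    ∑ μ ∈ Fintype.piFinset (fun i => Finset.range (ν i + 1)), G μ *
      ∑ κ ∈ Fintype.piFinset (fun i => Finset.Icc (lowB ν μ i) (uppB ν μ i)),
        wt a k x κ μ * wt a (k + 1) y ν κ := by
  simp only [Finset.sum_mul, Finset.mul_sum]
  rw [Finset.sum_comm' (fun κ μ => mem_iff ν κ μ)]
  simp only [mul_assoc]

lemma top_symm {M : ℕ} (a : ℤ → A) (k : ℕ) (x y : A) (ν : Fin (M + 1) → ℕ)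
    (G : (Fin (M + 1) → ℕ) → A) :
    ∑ κ ∈ inter ν, (∑ μ ∈ inter κ, G μ * wt a k x κ μ) * wt a (k + 1) y ν κ =
    ∑ κ ∈ inter ν, (∑ μ ∈ inter κ, G μ * wt a k y κ μ) * wt a (k + 1) x ν κ := by
  rw [top_expand, top_expand]
  apply Finset.sum_congr rfl
  intro μ hμ
  have hμ' : ∀ i, μ i ≤ ν i := by
    intro i
    have := Fintype.mem_piFinset.1 hμ i
    rw [Finset.mem_range] at this
    omega
  rw [inner_eq a k x y ν μ hμ', inner_eq a k y x ν μ hμ', left_eq, left_eq]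
  simp only [mid_symm _ x y]
  ring

/-- The cells of a tuple. -/
def cellsOf {N : ℕ} (ν : Fin N → ℕ) : Finset (ℕ × ℕ) :=
  (Finset.range N ×ˢ Finset.range (Finset.univ.sup ν)).filter (fun c => c.2 < ext ν c.1)

lemma mem_cellsOf {N : ℕ} (ν : Fin N → ℕ) (c : ℕ × ℕ) : c ∈ cellsOf ν ↔ c.2 < ext ν c.1 := by
  simp only [cellsOf, Finset.mem_filter, Finset.mem_product, Finset.mem_range, and_iff_right_iff_imp]
  intro h
  unfold ext at h
  split_ifs at h with h'
  · exact ⟨h', lt_of_lt_of_le h (Finset.le_sup (f := ν) (Finset.mem_univ _))⟩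
  · omega

/-- `t` is what remains of `s` after removing a horizontal strip. -/
def Good (s t : Finset (ℕ × ℕ)) : Prop :=
  t ⊆ s ∧ (∀ c ∈ s, c ∉ t → ∀ c' ∈ t, c.1 = c'.1 → ¬ c.2 ≤ c'.2) ∧
    (∀ c ∈ s, c ∉ t → ∀ c' ∈ s, c.2 = c'.2 → ¬ c.1 < c'.1)

open Classical in
lemma sgen_eq (n : ℕ) (s : Finset (ℕ × ℕ)) (x : Fin n → A) (a : ℤ → A) :
    sgen n s x a = ∑ T : s → Fin n with IsSsyt s T,
      ∏ c : s, (x (T c) - a ((T c : ℤ) + 1 + ((c : ℕ × ℕ).2 : ℤ) - ((c : ℕ × ℕ).1 : ℤ))) := by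
  unfold sgen
  rw [finsum_mem_eq_finite_toFinset_sum _ (Set.toFinite _)]
  apply Finset.sum_congr _ (fun _ _ => rfl)
  ext T
  simp

/-- extension of a filling by the largest letter -/
noncomputable def extT {n : ℕ} (s t : Finset (ℕ × ℕ)) (T : t → Fin n) : s → Fin (n + 1) :=
  fun c => if h : (c : ℕ × ℕ) ∈ t then (T ⟨c, h⟩).castSucc else Fin.last n

/-- cells whose entry is not the largest letter -/
noncomputable def lowPart {n : ℕ} (s : Finset (ℕ × ℕ)) (T : s → Fin (n + 1)) : Finset (ℕ × ℕ) :=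
  (Finset.univ.filter (fun c : s => T c ≠ Fin.last n)).map (Function.Embedding.subtype _)

lemma mem_lowPart {n : ℕ} (s : Finset (ℕ × ℕ)) (T : s → Fin (n + 1)) (c : ℕ × ℕ) :
    c ∈ lowPart s T ↔ ∃ h : c ∈ s, T ⟨c, h⟩ ≠ Fin.last n := by
  simp [lowPart]

lemma extT_ssyt {n : ℕ} (s t : Finset (ℕ × ℕ)) (T : t → Fin n) (hg : Good s t)
    (hT : IsSsyt t T) : IsSsyt s (extT s t T) := by
  obtain ⟨hts, hr, hc⟩ := hg
  constructor
  · intro c c' h1 h2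
    unfold extT
    by_cases h' : (c' : ℕ × ℕ) ∈ t
    · by_cases h : (c : ℕ × ℕ) ∈ t
      · simp only [h, h', dite_true, Fin.castSucc_le_castSucc_iff]
        exact hT.1 _ _ h1 h2
      · exact absurd h2 (hr c c.2 h c' h' h1)
    · simp only [h', dite_false]
      exact Fin.le_last _
  · intro c c' h1 h2
    unfold extT
    by_cases h : (c : ℕ × ℕ) ∈ t
    · by_cases h' : (c' : ℕ × ℕ) ∈ t
      · simp only [h, h', dite_true, Fin.castSucc_lt_castSucc_iff]
        exact hT.2 _ _ h1 h2
      · simp only [h, h', dite_true, dite_false]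
        exact Fin.castSucc_lt_last _
    · exact absurd h1 (hc c c.2 h c' c'.2 h2)

lemma extT_inj {n : ℕ} (s t : Finset (ℕ × ℕ)) (hts : t ⊆ s) (T T' : t → Fin n)
    (h : extT s t T = extT s t T') : T = T' := by
  funext c
  have := congrFun h ⟨c, hts c.2⟩
  simpa [extT] using this

lemma lowPart_extT {n : ℕ} (s t : Finset (ℕ × ℕ)) (hts : t ⊆ s) (T : t → Fin n) :
    lowPart s (extT s t T) = t := by
  ext c
  rw [mem_lowPart]
  constructor
  · rintro ⟨h, h1⟩
    by_contra h2
    exact h1 (by simp [extT, h2])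
  · intro h
    refine ⟨hts h, ?_⟩
    simp [extT, h, Fin.castSucc_ne_last]

lemma lowPart_good {n : ℕ} (s : Finset (ℕ × ℕ)) (T : s → Fin (n + 1)) (hT : IsSsyt s T) :
    Good s (lowPart s T) := by
  refine ⟨fun c hc => ((mem_lowPart s T c).1 hc).1, ?_, ?_⟩
  · intro c hc hct c' hc' h1 h2
    rw [mem_lowPart] at hct hc'
    push Not at hct
    obtain ⟨h3, h4⟩ := hc'
    have := hT.1 ⟨c, hc⟩ ⟨c', h3⟩ h1 h2
    rw [hct hc] at this
    exact h4 (Fin.last_le_iff.1 this)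
  · intro c hc hct c' hc' h1 h2
    rw [mem_lowPart] at hct
    push Not at hct
    have := hT.2 ⟨c, hc⟩ ⟨c', hc'⟩ h2 h1
    rw [hct hc] at this
    exact absurd (Fin.le_last _) (not_le.2 this)

lemma exists_extT {n : ℕ} (s : Finset (ℕ × ℕ)) (T : s → Fin (n + 1)) (hT : IsSsyt s T) :
    ∃ T' : lowPart s T → Fin n, IsSsyt _ T' ∧ extT s (lowPart s T) T' = T := by
  have hm : ∀ c : lowPart s T, ∃ h : (c : ℕ × ℕ) ∈ s, T ⟨c, h⟩ ≠ Fin.last n :=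
    fun c => (mem_lowPart s T c).1 c.2
  choose h1 h2 using hm
  refine ⟨fun c => (T ⟨c, h1 c⟩).castPred (h2 c), ⟨?_, ?_⟩, ?_⟩
  · intro c c' h3 h4
    simpa using hT.1 ⟨c, h1 c⟩ ⟨c', h1 c'⟩ h3 h4
  · intro c c' h3 h4
    simpa using hT.2 ⟨c, h1 c⟩ ⟨c', h1 c'⟩ h3 h4
  · funext c
    unfold extT
    split_ifs with h
    · simp
    · rw [mem_lowPart] at h
      push Not at h
      exact (h c.2).symm

lemma prod_extT {n : ℕ} (s t : Finset (ℕ × ℕ)) (hts : t ⊆ s) (T : t → Fin n)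
    (x : Fin (n + 1) → A) (a : ℤ → A) :
    ∏ c : s, (x (extT s t T c) -
      a ((extT s t T c : ℤ) + 1 + ((c : ℕ × ℕ).2 : ℤ) - ((c : ℕ × ℕ).1 : ℤ))) =
    (∏ c : t, (x (T c).castSucc - a ((T c : ℤ) + 1 + ((c : ℕ × ℕ).2 : ℤ) - ((c : ℕ × ℕ).1 : ℤ)))) *
    ∏ c ∈ s \ t, (x (Fin.last n) - a ((n : ℤ) + 1 + (c.2 : ℤ) - (c.1 : ℤ))) := by
  let f : ℕ × ℕ → A := fun c =>
    if h : c ∈ t then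
      (x (T ⟨c, h⟩).castSucc - a ((T ⟨c, h⟩ : ℤ) + 1 + (c.2 : ℤ) - (c.1 : ℤ)))
    else (x (Fin.last n) - a ((n : ℤ) + 1 + (c.2 : ℤ) - (c.1 : ℤ)))
  have e1 : ∏ c : s, (x (extT s t T c) -
      a ((extT s t T c : ℤ) + 1 + ((c : ℕ × ℕ).2 : ℤ) - ((c : ℕ × ℕ).1 : ℤ))) = ∏ c : s, f c := by
    apply Finset.prod_congr rfl
    intro c _
    by_cases h : (c : ℕ × ℕ) ∈ t
    · simp [f, extT, h]
    · simp [f, extT, h]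
  have e2 : (∏ c : t, (x (T c).castSucc -
      a ((T c : ℤ) + 1 + ((c : ℕ × ℕ).2 : ℤ) - ((c : ℕ × ℕ).1 : ℤ)))) = ∏ c : t, f c := by
    apply Finset.prod_congr rfl
    intro c _
    simp [f]
  have e3 : ∏ c ∈ s \ t, (x (Fin.last n) - a ((n : ℤ) + 1 + (c.2 : ℤ) - (c.1 : ℤ))) =
      ∏ c ∈ s \ t, f c := by
    apply Finset.prod_congr rfl
    intro c hc
    simp [f, (Finset.mem_sdiff.1 hc).2]
  rw [e1, e2, e3, Finset.prod_coe_sort s f, Finset.prod_coe_sort t f, mul_comm,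
    Finset.prod_sdiff hts]

open Classical in
lemma sgen_succ (n : ℕ) (s : Finset (ℕ × ℕ)) (x : Fin (n + 1) → A) (a : ℤ → A) :
    sgen (n + 1) s x a = ∑ t ∈ s.powerset with Good s t,
      sgen n t (fun i => x i.castSucc) a *
        ∏ c ∈ s \ t, (x (Fin.last n) - a ((n : ℤ) + 1 + (c.2 : ℤ) - (c.1 : ℤ))) := by
  rw [sgen_eq]
  have hmap : ∀ T ∈ (Finset.univ : Finset (s → Fin (n + 1))).filter (fun T => IsSsyt s T),
      lowPart s T ∈ s.powerset.filter (fun t => Good s t) := by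
    intro T hT
    have hT' := lowPart_good s T (Finset.mem_filter.1 hT).2
    exact Finset.mem_filter.2 ⟨Finset.mem_powerset.2 hT'.1, hT'⟩
  rw [← Finset.sum_fiberwise_of_maps_to hmap]
  apply Finset.sum_congr rfl
  intro t ht
  have hg := (Finset.mem_filter.1 ht).2
  rw [sgen_eq, Finset.sum_mul]
  symm
  apply Finset.sum_bij (fun T _ => extT s t T)
  · intro T hT
    simp only [Finset.mem_filter, Finset.mem_univ, true_and] at hT ⊢
    exact ⟨extT_ssyt s t T hg hT, lowPart_extT s t hg.1 T⟩
  · intro T _ T' _ h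
    exact extT_inj s t hg.1 T T' h
  · intro T hT
    simp only [Finset.mem_filter, Finset.mem_univ, true_and] at hT
    obtain ⟨hT, rfl⟩ := hT
    obtain ⟨T', h1, h2⟩ := exists_extT s T hT
    exact ⟨T', by simpa using h1, h2⟩
  · intro T _
    exact (prod_extT s t hg.1 T x a).symm

lemma ext_anti {N : ℕ} (ν : Fin N → ℕ) (hν : Antitone ν) : Antitone (ext ν) := by
  intro i j hij
  unfold ext
  split_ifs with h1 h2
  · exact hν (by simpa using hij)
  · omega
  · omega
  · exact le_rfl

lemma inter_le {N : ℕ} {ν κ : Fin N → ℕ} (h : κ ∈ inter ν) (i : ℕ) : ext κ i ≤ ext ν i := by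
  unfold ext
  split_ifs with h1
  · exact (Finset.mem_Icc.1 (Fintype.mem_piFinset.1 h ⟨i, h1⟩)).2
  · exact le_rfl

lemma inter_ge {N : ℕ} {ν κ : Fin N → ℕ} (h : κ ∈ inter ν) (i : ℕ) : ext ν (i + 1) ≤ ext κ i := by
  by_cases h1 : i < N
  · have := (Finset.mem_Icc.1 (Fintype.mem_piFinset.1 h ⟨i, h1⟩)).1
    simpa [ext, h1] using this
  · have : ¬ i + 1 < N := by omega
    simp [ext, this]

lemma inter_anti {N : ℕ} {ν κ : Fin N → ℕ} (h : κ ∈ inter ν) : Antitone κ := by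
  have : Antitone (ext κ) := antitone_nat_of_succ_le
    (fun i => (inter_le h (i + 1)).trans (inter_ge h i))
  intro i j hij
  have := this (show (i : ℕ) ≤ j from hij)
  simpa [ext_fin] using this

lemma cells_good {N : ℕ} {ν κ : Fin N → ℕ} (hν : Antitone ν) (h : κ ∈ inter ν) :
    Good (cellsOf ν) (cellsOf κ) := by
  refine ⟨fun c hc => ?_, ?_, ?_⟩
  · rw [mem_cellsOf] at hc ⊢
    exact hc.trans_le (inter_le h _)
  · intro c _ hc c' hc' h1 h2
    rw [mem_cellsOf] at hc hc'
    rw [h1] at hc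
    omega
  · intro c _ hc c' hc' h1 h2
    rw [mem_cellsOf] at hc hc'
    have h3 := inter_ge h c.1
    have h4 := ext_anti ν hν (show c.1 + 1 ≤ c'.1 from h2)
    omega

lemma cells_inj {N : ℕ} {κ κ' : Fin N → ℕ} (h : cellsOf κ = cellsOf κ') : κ = κ' := by
  funext i
  have h1 : ∀ j, j < κ i ↔ j < κ' i := by
    intro j
    have := congrArg (fun s => ((i : ℕ), j) ∈ s) h
    simpa [mem_cellsOf, ext_fin] using this
  have h2 := h1 (κ i)
  have h3 := h1 (κ' i)
  omega

lemma good_cells {N : ℕ} {ν : Fin N → ℕ} (hν : Antitone ν) (t : Finset (ℕ × ℕ))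
    (h : Good (cellsOf ν) t) : ∃ κ ∈ inter ν, cellsOf κ = t := by
  classical
  obtain ⟨hts, hr, hc⟩ := h
  have hex : ∀ i : ℕ, ∃ j, (i, j) ∉ t := by
    intro i
    refine ⟨ext ν i, fun h => ?_⟩
    have := (mem_cellsOf ν _).1 (hts h)
    simp at this
  let K : ℕ → ℕ := fun i => Nat.find (hex i)
  have hK : ∀ i j, (i, j) ∈ t ↔ j < K i := by
    intro i j
    constructor
    · intro hij
      by_contra hcon
      have h1 : (i, K i) ∉ t := Nat.find_spec (hex i)
      have h2 := (mem_cellsOf ν _).1 (hts hij)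
      have h3 : (i, K i) ∈ cellsOf ν := by
        rw [mem_cellsOf]
        simp only at h2 ⊢
        omega
      exact hr _ h3 h1 _ hij rfl (by simpa using hcon)
    · intro hij
      by_contra hcon
      exact Nat.find_min (hex i) hij hcon
  have hext : ∀ i, ext (fun i : Fin N => K i) i = K i := by
    intro i
    unfold ext
    split_ifs with h1
    · rfl
    · by_contra h2
      have h3 := (hK i 0).2 (by omega)
      have h4 := (mem_cellsOf ν _).1 (hts h3)
      simp [ext, h1] at h4
  refine ⟨fun i => K i, ?_, ?_⟩
  · rw [inter, Fintype.mem_piFinset]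
    intro i
    rw [Finset.mem_Icc]
    constructor
    · by_contra hcon
      have h1 : ((i : ℕ), K i) ∉ t := Nat.find_spec (hex i)
      have h2 : ((i : ℕ) + 1, K i) ∈ cellsOf ν := by
        rw [mem_cellsOf]
        simpa using hcon
      have h3 : ((i : ℕ), K i) ∈ cellsOf ν := by
        rw [mem_cellsOf] at h2 ⊢
        exact h2.trans_le (ext_anti ν hν (Nat.le_succ _))
      exact hc _ h3 h1 _ h2 rfl (Nat.lt_succ_self _)
    · by_contra hcon
      have h1 := (hK i (ν i)).2 (by omega)
      have h2 := (mem_cellsOf ν _).1 (hts h1)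
      simp [ext_fin] at h2
  · ext ⟨i, j⟩
    rw [mem_cellsOf, hext, hK]

lemma prod_cells {N : ℕ} (ν κ : Fin N → ℕ) (f : ℕ × ℕ → A) :
    ∏ c ∈ cellsOf ν \ cellsOf κ, f c = ∏ i : Fin N, ∏ j ∈ Finset.Ico (κ i) (ν i), f (i, j) := by
  rw [Finset.prod_sigma']
  symm
  apply Finset.prod_bij (fun (p : (_ : Fin N) × ℕ) _ => ((p.1 : ℕ), p.2))
  · rintro ⟨i, j⟩ h
    simp only [Finset.mem_sigma, Finset.mem_univ, true_and, Finset.mem_Ico] at h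
    simp only [Finset.mem_sdiff, mem_cellsOf, ext_fin]
    omega
  · rintro ⟨i, j⟩ _ ⟨i', j'⟩ _ h
    simp only [Prod.mk.injEq] at h
    obtain ⟨h1, rfl⟩ := h
    obtain rfl := Fin.ext h1
    rfl
  · rintro ⟨i, j⟩ h
    simp only [Finset.mem_sdiff, mem_cellsOf] at h
    have hi : i < N := by
      by_contra hi
      simp [ext, hi] at h
    simp only [ext, hi, dite_true] at h
    exact ⟨⟨⟨i, hi⟩, j⟩, by simpa [and_comm] using h, rfl⟩
  · intros; rfl

lemma sgen_cells {N : ℕ} (n : ℕ) (ν : Fin N → ℕ) (hν : Antitone ν) (x : Fin (n + 1) → A)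
    (a : ℤ → A) :
    sgen (n + 1) (cellsOf ν) x a = ∑ κ ∈ inter ν,
      sgen n (cellsOf κ) (fun i => x i.castSucc) a * wt a n (x (Fin.last n)) ν κ := by
  classical
  rw [sgen_succ]
  symm
  apply Finset.sum_bij (fun κ _ => cellsOf κ)
  · intro κ hκ
    have := cells_good hν hκ
    exact Finset.mem_filter.2 ⟨Finset.mem_powerset.2 this.1, this⟩
  · intro κ _ κ' _ h
    exact cells_inj h
  · intro t ht
    obtain ⟨κ, h1, h2⟩ := good_cells hν t (Finset.mem_filter.1 ht).2
    exact ⟨κ, h1, h2⟩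
  · intro κ _
    rw [prod_cells]
    rfl

lemma sgen_swap {M : ℕ} (n : ℕ) (a : ℤ → A) : ∀ (ν : Fin (M + 1) → ℕ) (_ : Antitone ν)
    (x : Fin (n + 1) → A) (i : Fin n),
    sgen (n + 1) (cellsOf ν) (fun j => x (Equiv.swap i.castSucc i.succ j)) a =
      sgen (n + 1) (cellsOf ν) x a := by
  induction n with
  | zero => intro _ _ _ i; exact i.elim0
  | succ n ih =>
    intro ν hν x i
    refine Fin.lastCases ?_ (fun i => ?_) i
    · have key : ∀ y : Fin (n + 2) → A, sgen (n + 2) (cellsOf ν) y a =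
          ∑ κ ∈ inter ν, (∑ μ ∈ inter κ, sgen n (cellsOf μ) (fun i => y i.castSucc.castSucc) a *
            wt a n (y (Fin.last n).castSucc) κ μ) * wt a (n + 1) (y (Fin.last (n + 1))) ν κ := by
        intro y
        rw [sgen_cells (n + 1) ν hν]
        apply Finset.sum_congr rfl
        intro κ hκ
        rw [sgen_cells n κ (inter_anti hκ)]
      rw [key, key x, ← top_symm]
      have e : ∀ j : Fin n, Equiv.swap (Fin.last n).castSucc (Fin.last n).succ
          j.castSucc.castSucc = j.castSucc.castSucc := by
        intro j
        apply Equiv.swap_apply_of_ne_of_ne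
        · simp [Fin.ext_iff]; omega
        · simp [Fin.ext_iff]; omega
      have e' : (Fin.last n).succ = Fin.last (n + 1) := rfl
      simp only [e]
      rw [e', Equiv.swap_apply_left, Equiv.swap_apply_right]
    · rw [sgen_cells (n + 1) ν hν, sgen_cells (n + 1) ν hν]
      apply Finset.sum_congr rfl
      intro κ hκ
      have e1 : Equiv.swap i.castSucc.castSucc i.castSucc.succ (Fin.last (n + 1)) =
          Fin.last (n + 1) := by
        apply Equiv.swap_apply_of_ne_of_ne
        · simp [Fin.ext_iff]; omega
        · simp [Fin.ext_iff]; omega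
      have e2 : ∀ j : Fin (n + 1), Equiv.swap i.castSucc.castSucc i.castSucc.succ j.castSucc =
          (Equiv.swap i.castSucc i.succ j).castSucc := by
        intro j
        simp only [Equiv.swap_apply_def, Fin.ext_iff, Fin.val_castSucc, Fin.val_succ]
        split_ifs <;> simp
      rw [e1]
      simp only [e2]
      rw [ih κ (inter_anti hκ) (fun j => x j.castSucc) i]

lemma sgen_perm {M : ℕ} (n : ℕ) (a : ℤ → A) (ν : Fin (M + 1) → ℕ) (hν : Antitone ν)
    (σ : Equiv.Perm (Fin (n + 1))) (x : Fin (n + 1) → A) :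
    sgen (n + 1) (cellsOf ν) (fun j => x (σ j)) a = sgen (n + 1) (cellsOf ν) x a := by
  have hσ : σ ∈ Submonoid.closure
      (Set.range fun i : Fin n => Equiv.swap i.castSucc i.succ) := by
    rw [Equiv.Perm.mclosure_swap_castSucc_succ]
    trivial
  induction hσ using Submonoid.closure_induction generalizing x with
  | mem σ h =>
    obtain ⟨i, rfl⟩ := h
    exact sgen_swap n a ν hν x i
  | one => rfl
  | mul σ τ _ _ h1 h2 =>
    have := h2 (fun j => x (σ j))
    rw [h1 x] at this
    exact this

end Aux

/-- Termwise vanishing for the reversed tuple. -/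
lemma rev_vanish {A : Type} [CommRing A] (n : ℕ) (a : ℤ → A) (lam rho : YoungDiagram)
    (h : ¬ lam ≤ rho) :
    sgen n lam.cells (fun i => subA n a rho i.rev) a = 0 := by
  classical
  rw [sgen_eq]
  apply Finset.sum_eq_zero
  intro T hT
  simp only [Finset.mem_filter, Finset.mem_univ, true_and] at hT
  by_contra hne
  apply h
  have hcell : ∀ c : lam.cells, (rho.rowLen (T c).rev : ℤ) ≠ ((c : ℕ × ℕ).2 : ℤ) - (c : ℕ × ℕ).1 := by
    intro c hc
    apply hne
    apply Finset.prod_eq_zero (Finset.mem_univ c)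
    rw [sub_eq_zero]
    unfold subA
    congr 1
    have hlt := (T c).isLt
    rw [Fin.val_rev] at hc ⊢
    omega
  have hrow : ∀ j (hj : ((0 : ℕ), j) ∈ lam.cells), j < rho.rowLen (T ⟨(0, j), hj⟩).rev := by
    intro j
    induction j with
    | zero =>
      intro hj
      have := hcell ⟨(0, 0), hj⟩
      simp only at this
      omega
    | succ j ih =>
      intro hj
      have hj' : ((0 : ℕ), j) ∈ lam.cells := lam.isLowerSet (by simp [Prod.le_def]) hj
      have h1 := ih hj'
      have h2 := hT.1 ⟨(0, j), hj'⟩ ⟨(0, j + 1), hj⟩ rfl (Nat.le_succ _)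
      have h3 : rho.rowLen (T ⟨(0, j), hj'⟩).rev ≤ rho.rowLen (T ⟨(0, j + 1), hj⟩).rev :=
        rho.rowLen_anti _ _ (Fin.rev_le_rev.2 h2)
      have := hcell ⟨(0, j + 1), hj⟩
      simp only at this
      omega
  rintro ⟨i, j⟩ hij
  have hcol : ∀ i (hi : (i, j) ∈ lam.cells) (h0 : (0, j) ∈ lam.cells),
      (T ⟨(0, j), h0⟩ : ℕ) + i ≤ T ⟨(i, j), hi⟩ := by
    intro i
    induction i with
    | zero => intro _ _; simp
    | succ i ih =>
      intro hi h0
      have hi' : (i, j) ∈ lam.cells := lam.isLowerSet (by simp [Prod.le_def]) hi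
      have h1 := ih hi' h0
      have h2 := hT.2 ⟨(i, j), hi'⟩ ⟨(i + 1, j), hi⟩ (Nat.lt_succ_self _) rfl
      rw [Fin.lt_def] at h2
      omega
  have h0 : ((0 : ℕ), j) ∈ lam.cells := lam.isLowerSet (by simp [Prod.le_def]) hij
  have h1 := hcol i hij h0
  have h2 := hrow j h0
  have h3 := (T ⟨(i, j), hij⟩).isLt
  have h4 : rho.rowLen (T ⟨(0, j), h0⟩).rev ≤ rho.rowLen i := by
    apply rho.rowLen_anti
    rw [Fin.val_rev]
    omega
  exact YoungDiagram.mem_iff_lt_rowLen.2 (h2.trans_le h4)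

lemma cells_eq (n : ℕ) (lam : YoungDiagram) (hlam : lam.colLen 0 ≤ n) :
    lam.cells = cellsOf (fun i : Fin n => lam.rowLen i) := by
  ext ⟨i, j⟩
  rw [mem_cellsOf, YoungDiagram.mem_cells]
  unfold ext
  split_ifs with h
  · exact YoungDiagram.mem_iff_lt_rowLen
  · simp only [Nat.not_lt_zero, iff_false]
    intro hij
    have h1 : (i, 0) ∈ lam := lam.isLowerSet (by simp [Prod.le_def]) hij
    have := YoungDiagram.mem_iff_lt_colLen.1 h1
    omega

/-- **Vanishing Theorem, part 1.** If `λ ⊄ ρ` then `s_λ(a_ρ|a) = 0` in `ℤ[a_i : i ∈ ℤ]`. -/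
theorem vanishing_of_not_subset (n : ℕ) (hn : 1 ≤ n) (lam rho : YoungDiagram)
    (hlam : lam.colLen 0 ≤ n) (hrho : rho.colLen 0 ≤ n) (h : ¬ lam ≤ rho) :
    sgen n lam.cells (subA n (fun k => (MvPolynomial.X k : MvPolynomial ℤ ℤ)) rho)
      (fun k => MvPolynomial.X k) = 0 := by
  obtain ⟨m, rfl⟩ : ∃ m, n = m + 1 := ⟨n - 1, by omega⟩
  rw [← rev_vanish (m + 1) (fun k => (MvPolynomial.X k : MvPolynomial ℤ ℤ)) lam rho h,
    cells_eq (m + 1) lam hlam]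
  exact (sgen_perm m _ _ (fun i j hij => lam.rowLen_anti _ _ hij) Fin.revPerm _).symm

end FactorialLR
end

section
/- Let F be a field, k ≥ 2, and u_1, …, u_k elements of F such that u_1 ≠ u_j for all j = 2,…,k and u_k ≠ u_j for all j = 1,…,k−1. Then Σ_{i=1}^k 1/[ (u_1−u_2)(u_1−u_3)⋯(u_1−u_i) · (u_k−u_i)(u_k−u_{i+1})⋯(u_k−u_{k−1}) ] = 0, where an empty product in the denominator equals 1 (so the i = 1 term is 1/[(u_k−u_1)⋯(u_k−u_{k−1})] and the i = k term is 1/[(u_1−u_2)⋯(u_1−u_k)]). -/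
open scoped BigOperators

namespace FactorialLR

theorem partial_aux (F : Type) [Field F] (n : ℕ) (u : ℕ → F) (b : F)
    (h1 : ∀ j, 2 ≤ j → j ≤ n → u 1 - u j ≠ 0)
    (hkk : ∀ j, 1 ≤ j → j ≤ n → b - u j ≠ 0) (m : ℕ) (hm : 1 ≤ m) : m ≤ n →
    (b - u 1) * ∑ i ∈ Finset.Icc 1 m,
      ((∏ j ∈ Finset.Icc 2 i, (u 1 - u j)) * ∏ j ∈ Finset.Icc i n, (b - u j))⁻¹
      = ((∏ j ∈ Finset.Icc 2 m, (u 1 - u j)) * ∏ j ∈ Finset.Icc (m + 1) n, (b - u j))⁻¹ := by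
  have hB : ∀ i, i ≤ n → ∏ j ∈ Finset.Icc i n, (b - u j)
      = (b - u i) * ∏ j ∈ Finset.Icc (i + 1) n, (b - u j) := by
    intro i hi
    rw [← Finset.insert_Icc_add_one_left_eq_Icc hi, Finset.prod_insert (by simp)]
  induction m, hm using Nat.le_induction with
  | base =>
    intro hn
    have h := hkk 1 le_rfl hn
    simp only [Finset.Icc_self, Finset.sum_singleton]
    rw [hB 1 hn]
    simp only [mul_inv]
    field_simp
  | succ m hm ih =>
    intro hn
    rw [Finset.sum_Icc_succ_top (by omega), mul_add, ih (by omega), hB (m + 1) hn,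
      Finset.prod_Icc_succ_top (by omega)]
    have ha := h1 (m + 1) (by omega) hn
    have hb := hkk (m + 1) (by omega) hn
    have hA : ∏ j ∈ Finset.Icc 2 m, (u 1 - u j) ≠ 0 :=
      Finset.prod_ne_zero_iff.2 fun j hj => by
        rw [Finset.mem_Icc] at hj; exact h1 j hj.1 (by omega)
    have hC : ∏ j ∈ Finset.Icc (m + 1 + 1) n, (b - u j) ≠ 0 :=
      Finset.prod_ne_zero_iff.2 fun j hj => by
        rw [Finset.mem_Icc] at hj; exact hkk j (by omega) hj.2
    field_simp
    ring

/-- `Σ_{i=1}^k 1/[(u_1−u_2)⋯(u_1−u_i)·(u_k−u_i)⋯(u_k−u_{k−1})] = 0`. -/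
theorem partial_fraction_identity (F : Type) [Field F] (k : ℕ) (hk : 2 ≤ k) (u : ℕ → F)
    (h1 : ∀ j, 2 ≤ j → j ≤ k → u 1 ≠ u j)
    (hkk : ∀ j, 1 ≤ j → j ≤ k - 1 → u k ≠ u j) :
    ∑ i ∈ Finset.Icc 1 k,
      ((∏ j ∈ Finset.Icc 2 i, (u 1 - u j)) * ∏ j ∈ Finset.Icc i (k - 1), (u k - u j))⁻¹
      = 0 := by
  obtain ⟨n, rfl⟩ : ∃ n, k = n + 1 := ⟨k - 1, by omega⟩
  simp only [Nat.add_sub_cancel] at *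
  have key := partial_aux F n u (u (n + 1))
    (fun j h h' => sub_ne_zero.2 (h1 j h (by omega)))
    (fun j h h' => sub_ne_zero.2 (hkk j h h')) n (by omega) le_rfl
  have hne : u (n + 1) - u 1 ≠ 0 := sub_ne_zero.2 (hkk 1 le_rfl (by omega))
  have hne' : u 1 - u (n + 1) ≠ 0 := sub_ne_zero.2 (h1 (n + 1) hk le_rfl)
  apply (mul_eq_zero.1 _).resolve_left hne
  rw [Finset.sum_Icc_succ_top (by omega), mul_add, key, Finset.prod_Icc_succ_top (by omega)]
  simp only [mul_inv, Finset.Icc_eq_empty_of_lt (Nat.lt_succ_self n), Finset.prod_empty]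
  generalize (∏ j ∈ Finset.Icc 2 n, (u 1 - u j))⁻¹ = A
  field_simp
  ring

end FactorialLR
end

section
/- Let n ≥ 1 and let ρ ⊊ ν be partitions with at most n parts. Then, in the field ℚ(a_i : i ∈ ℤ), Σ_{σ : ρ ⊆ σ ⊆ ν} H'(ρ,σ)·H(σ,ν) = 0, where the sum is over all partitions σ with ρ ⊆ σ ⊆ ν. -/
open scoped BigOperators

namespace FactorialLR

/-- `|a_ρ| = a_{ρ_1+n} + ⋯ + a_{ρ_n+1}`. -/
noncomputable def aNorm {A : Type} [CommRing A] (n : ℕ) (a : ℤ → A) (ρ : YoungDiagram) : A :=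
  ∑ i : Fin n, subA n a ρ i

/-- `μ → ν` : `ν` is obtained from `μ` by adding a single cell. -/
def Covers (μ ν : YoungDiagram) : Prop :=
  μ ≤ ν ∧ ν.card = μ.card + 1

/-- Chains `μ = ρ⁽⁰⁾ → ρ⁽¹⁾ → ⋯ → ρ⁽ˡ⁾ = ν` of Young diagrams, encoded as lists. -/
def chainSet (μ ν : YoungDiagram) : Set (List YoungDiagram) :=
  {L | L.Chain' Covers ∧ L.head? = some μ ∧ L.getLast? = some ν}

/-- `H(μ,ρ)`: the sum over all chains `μ = ρ⁽⁰⁾ → ⋯ → ρ⁽ʳ⁾ = ρ` of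
`∏_{i=0}^{r-1} 1/(|a_ρ| − |a_{ρ⁽ⁱ⁾}|)`; in particular `H(μ,μ) = 1`. -/
noncomputable def H {K : Type} [Field K] (n : ℕ) (a : ℤ → K) (μ ρ : YoungDiagram) : K :=
  ∑ᶠ L ∈ chainSet μ ρ,
    (L.dropLast.map fun σ => (aNorm n a ρ - aNorm n a σ)⁻¹).prod

/-- `H'(ρ,ν)`: the sum over all chains `ρ = ρ⁽ʳ⁾ → ⋯ → ρ⁽ˡ⁾ = ν` of
`∏_{i=r+1}^{l} 1/(|a_ρ| − |a_{ρ⁽ⁱ⁾}|)`; in particular `H'(ρ,ρ) = 1`. -/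
noncomputable def H' {K : Type} [Field K] (n : ℕ) (a : ℤ → K) (ρ ν : YoungDiagram) : K :=
  ∑ᶠ L ∈ chainSet ρ ν,
    (L.tail.map fun σ => (aNorm n a ρ - aNorm n a σ)⁻¹).prod

/-- The field `ℚ(a_i : i ∈ ℤ)` of rational functions in the variables `a_i`, `i ∈ ℤ`. -/
noncomputable abbrev Kfield : Type := FractionRing (MvPolynomial ℤ ℚ)

/-- The variables `a_i`, `i ∈ ℤ`, as elements of `Kfield`. -/
noncomputable def aK : ℤ → Kfield :=
  fun k => algebraMap (MvPolynomial ℤ ℚ) Kfield (MvPolynomial.X k)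

theorem finite_Iic (nu : YoungDiagram) : {s : YoungDiagram | s ≤ nu}.Finite := by
  have h : (Set.Iic nu.cells).Finite := Set.toFinite _
  refine (h.preimage (f := YoungDiagram.cells) ?_).subset ?_
  · intro a _ b _ hab
    exact YoungDiagram.ext hab
  · intro s hs
    exact hs

theorem chain_cons {mu nu : YoungDiagram} {L : List YoungDiagram} (hne : mu ≠ nu)
    (h : L ∈ chainSet mu nu) : ∃ t M, L = mu :: M ∧ Covers mu t ∧ M ∈ chainSet t nu := by
  obtain ⟨h1, h2, h3⟩ := h
  match L, h1, h2, h3 with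
  | [], _, h2, _ => simp at h2
  | [x], _, h2, h3 => simp at h2 h3; exact absurd (h2.symm.trans h3) hne
  | x :: t :: M, h1, h2, h3 =>
    simp at h2
    subst h2
    have h1' := List.isChain_cons_cons.1 h1
    exact ⟨t, t :: M, rfl, h1'.1, h1'.2, rfl, by simpa using h3⟩

theorem chain_of_cons {mu nu t : YoungDiagram} {M : List YoungDiagram} (hc : Covers mu t)
    (h : M ∈ chainSet t nu) : mu :: M ∈ chainSet mu nu := by
  obtain ⟨h1, h2, h3⟩ := h
  match M, h1, h2, h3 with
  | [], _, h2, _ => simp at h2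
  | x :: M, h1, h2, h3 =>
    simp at h2
    subst h2
    exact ⟨List.isChain_cons_cons.2 ⟨hc, h1⟩, rfl, by simpa using h3⟩

theorem chain_snoc {mu nu : YoungDiagram} {L : List YoungDiagram} (hne : mu ≠ nu)
    (h : L ∈ chainSet mu nu) : ∃ t M, L = M ++ [nu] ∧ Covers t nu ∧ M ∈ chainSet mu t := by
  obtain ⟨h1, h2, h3⟩ := h
  rcases List.eq_nil_or_concat L with rfl | ⟨M, x, rfl⟩
  · simp at h2
  simp at h3
  subst h3
  rcases List.eq_nil_or_concat M with rfl | ⟨N, t, rfl⟩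
  · simp at h2; exact absurd h2.symm hne
  simp only [List.concat_eq_append] at h1 h2 ⊢
  have h1' := List.isChain_append.1 h1
  refine ⟨t, N ++ [t], by simp, ?_, ?_, ?_, by simp⟩
  · exact h1'.2.2 t (by simp) x (by simp)
  · exact h1'.1
  · cases N <;> simpa using h2

theorem chain_of_snoc {mu nu t : YoungDiagram} {M : List YoungDiagram} (hc : Covers t nu)
    (h : M ∈ chainSet mu t) : M ++ [nu] ∈ chainSet mu nu := by
  obtain ⟨h1, h2, h3⟩ := h
  refine ⟨List.isChain_append.2 ⟨h1, by simp, ?_⟩, ?_, by simp⟩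
  · intro x hx y hy
    rw [h3] at hx
    simp at hx hy
    subst hx; subst hy; exact hc
  · cases M <;> simp_all

theorem chain_le : ∀ (L : List YoungDiagram) {mu nu : YoungDiagram}, L ∈ chainSet mu nu → mu ≤ nu
  | [], mu, nu, h => by
    have := h.2.1
    simp at this
  | x :: L, mu, nu, h => by
    by_cases hne : mu = nu
    · exact hne.le
    obtain ⟨t, M, he, hc, hM⟩ := chain_cons hne h
    have : L = M := by simpa using (List.cons.inj he).2
    subst this
    exact hc.1.trans (chain_le L hM)

theorem chain_self {mu : YoungDiagram} : chainSet mu mu = {[mu]} := by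
  ext L
  constructor
  · rintro ⟨h1, h2, h3⟩
    match L, h1, h2, h3 with
    | [], _, h2, _ => simp at h2
    | [x], _, h2, h3 => simp at h2; simp [h2]
    | x :: t :: M, h1, h2, h3 =>
      simp at h2
      subst h2
      have h1' := List.isChain_cons_cons.1 h1
      have hl := chain_le (t :: M) (mu := t) (nu := x) ⟨h1'.2, rfl, by simpa using h3⟩
      have h5 := Finset.card_le_card (YoungDiagram.cells_subset_iff.2 hl)
      have h6 := h1'.1.2
      simp only [YoungDiagram.card] at h6
      omega
  · rintro rfl
    exact ⟨List.isChain_singleton _, rfl, rfl⟩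

theorem chainSet_eq_cons {mu nu : YoungDiagram} (hne : mu ≠ nu) (F : Finset YoungDiagram)
    (hF : ∀ t, Covers mu t → t ≤ nu → t ∈ F) [DecidablePred (Covers mu)] :
    chainSet mu nu = ⋃ t ∈ ((F.filter (Covers mu) : Finset _) : Set YoungDiagram), (List.cons mu) '' chainSet t nu := by
  ext L
  simp only [Set.mem_iUnion, Finset.mem_coe, Finset.mem_filter, Set.mem_image]
  constructor
  · intro h
    obtain ⟨t, M, he, hc, hM⟩ := chain_cons hne h
    exact ⟨t, ⟨hF t hc (chain_le M hM), hc⟩, M, hM, he.symm⟩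
  · rintro ⟨t, ⟨_, hc⟩, M, hM, rfl⟩
    exact chain_of_cons hc hM

theorem chainSet_eq_snoc {mu nu : YoungDiagram} (hne : mu ≠ nu) (F : Finset YoungDiagram)
    (hF : ∀ t, Covers t nu → mu ≤ t → t ∈ F) [DecidablePred (fun t => Covers t nu)] :
    chainSet mu nu = ⋃ t ∈ ((F.filter (fun t => Covers t nu) : Finset _) : Set YoungDiagram),
      (fun M => M ++ [nu]) '' chainSet mu t := by
  ext L
  simp only [Set.mem_iUnion, Finset.mem_coe, Finset.mem_filter, Set.mem_image]
  constructor
  · intro h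
    obtain ⟨t, M, he, hc, hM⟩ := chain_snoc hne h
    exact ⟨t, ⟨hF t hc (chain_le M hM), hc⟩, M, hM, he.symm⟩
  · rintro ⟨t, ⟨_, hc⟩, M, hM, rfl⟩
    exact chain_of_snoc hc hM

theorem chainSet_finite (mu nu : YoungDiagram) : (chainSet mu nu).Finite := by
  classical
  induction h : nu.card using Nat.strong_induction_on generalizing nu with
  | _ k ih =>
    by_cases hne : mu = nu
    · subst hne; rw [chain_self]; exact Set.finite_singleton _
    · rw [chainSet_eq_snoc hne (finite_Iic nu).toFinset (fun t ht _ => by simpa using ht.1)]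
      refine Set.Finite.biUnion (Finset.finite_toSet _) (fun t ht => ?_)
      rw [Finset.mem_coe, Finset.mem_filter] at ht
      exact (ih t.card (by have := ht.2.2; omega) t rfl).image _

theorem sum_cons {K : Type} [Field K] (w : YoungDiagram → K) {mu nu : YoungDiagram}
    (hne : mu ≠ nu) (F : Finset YoungDiagram)
    (hF : ∀ t, Covers mu t → t ≤ nu → t ∈ F) [DecidablePred (Covers mu)] :
    ∑ᶠ L ∈ chainSet mu nu, (L.dropLast.map w).prod =
      w mu * ∑ t ∈ F.filter (Covers mu), ∑ᶠ L ∈ chainSet t nu, (L.dropLast.map w).prod := by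
  rw [chainSet_eq_cons hne F hF, finsum_mem_biUnion (I := ((F.filter (Covers mu) : Finset _) : Set _)) ?_ (Finset.finite_toSet _)
    (fun t _ => (chainSet_finite t nu).image _), finsum_mem_coe_finset, Finset.mul_sum]
  · refine Finset.sum_congr rfl (fun t _ => ?_)
    rw [finsum_mem_image (fun _ _ _ _ h => by simpa using h), mul_finsum_mem' _ _ (chainSet_finite t nu)]
    refine finsum_mem_congr rfl (fun L hL => ?_)
    have : L ≠ [] := by rintro rfl; simpa using hL.2.1
    rw [List.dropLast_cons_of_ne_nil this]
    simp
  · intro s _ t _ hst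
    rw [Function.onFun, Set.disjoint_left]
    rintro _ ⟨M, hM, rfl⟩ ⟨N, hN, h⟩
    have : N = M := by simpa using h
    subst this
    exact hst (Option.some.inj (hM.2.1.symm.trans hN.2.1))

theorem sum_snoc {K : Type} [Field K] (w : YoungDiagram → K) {mu nu : YoungDiagram}
    (hne : mu ≠ nu) (F : Finset YoungDiagram)
    (hF : ∀ t, Covers t nu → mu ≤ t → t ∈ F) [DecidablePred (fun t => Covers t nu)] :
    ∑ᶠ L ∈ chainSet mu nu, (L.tail.map w).prod =
      w nu * ∑ t ∈ F.filter (fun t => Covers t nu),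
        ∑ᶠ L ∈ chainSet mu t, (L.tail.map w).prod := by
  rw [chainSet_eq_snoc hne F hF, finsum_mem_biUnion (I := ((F.filter (fun t => Covers t nu) : Finset _) : Set _)) ?_ (Finset.finite_toSet _)
    (fun t _ => (chainSet_finite mu t).image _), finsum_mem_coe_finset, Finset.mul_sum]
  · refine Finset.sum_congr rfl (fun t _ => ?_)
    rw [finsum_mem_image (fun _ _ _ _ h => by simpa using h), mul_finsum_mem' _ _ (chainSet_finite mu t)]
    refine finsum_mem_congr rfl (fun L hL => ?_)
    have : L ≠ [] := by rintro rfl; simpa using hL.2.1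
    rw [List.tail_append_of_ne_nil this]
    simp [mul_comm]
  · intro s _ t _ hst
    rw [Function.onFun, Set.disjoint_left]
    rintro _ ⟨M, hM, rfl⟩ ⟨N, hN, h⟩
    have : N = M := by simpa using h
    subst this
    exact hst (Option.some.inj (hM.2.2.symm.trans hN.2.2))

theorem aNorm_ne (n : ℕ) {s t : YoungDiagram} (ht : t.colLen 0 ≤ n) (hst : s ≤ t) (hne : s ≠ t) :
    aNorm n aK s ≠ aNorm n aK t := by
  intro h
  have key : ∀ r : YoungDiagram, aNorm n aK r = algebraMap (MvPolynomial ℤ ℚ) Kfield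
      (∑ i : Fin n, MvPolynomial.X ((r.rowLen i : ℤ) + (n : ℤ) - (i : ℤ))) := by
    intro r
    simp [aNorm, subA, aK, map_sum]
  rw [key, key] at h
  have h2 := IsFractionRing.injective (MvPolynomial ℤ ℚ) Kfield h
  have h3 := congrArg (MvPolynomial.eval (fun k : ℤ => (k : ℚ))) h2
  simp only [map_sum, MvPolynomial.eval_X] at h3
  have hrow : ∀ i, s.rowLen i ≤ t.rowLen i := by
    intro i
    by_contra hc
    push Not at hc
    have h4 : (i, t.rowLen i) ∈ s := YoungDiagram.mem_iff_lt_rowLen.2 hc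
    have h5 : (i, t.rowLen i) ∈ t := hst h4
    exact lt_irrefl _ (YoungDiagram.mem_iff_lt_rowLen.1 h5)
  obtain ⟨⟨i, j⟩, h6, h7⟩ : ∃ c, c ∈ t ∧ c ∉ s := by
    by_contra hc
    push Not at hc
    exact hne (le_antisymm hst (fun c hc' => hc c hc'))
  have hi : i < n := by
    refine lt_of_lt_of_le ?_ ht
    exact YoungDiagram.mem_iff_lt_colLen.1 (t.up_left_mem le_rfl (Nat.zero_le j) h6)
  refine absurd h3 (ne_of_lt (Finset.sum_lt_sum (fun k _ => ?_) ⟨⟨i, hi⟩, Finset.mem_univ _, ?_⟩))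
  · have := hrow k
    exact_mod_cast (by omega : (s.rowLen k : ℤ) + n - k ≤ t.rowLen k + n - k)
  · rw [YoungDiagram.mem_iff_lt_rowLen] at h6 h7
    have : (s.rowLen i : ℤ) + n - i < t.rowLen i + n - i := by omega
    exact_mod_cast this

theorem colLen_le {s t : YoungDiagram} (hst : s ≤ t) : s.colLen 0 ≤ t.colLen 0 := by
  by_contra hc
  push Not at hc
  have h4 : (t.colLen 0, 0) ∈ s := YoungDiagram.mem_iff_lt_colLen.2 hc
  have h5 : (t.colLen 0, 0) ∈ t := hst h4
  exact lt_irrefl _ (YoungDiagram.mem_iff_lt_colLen.1 h5)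

/-- `Σ_{ρ ⊆ σ ⊆ ν} H'(ρ,σ)·H(σ,ν) = 0` for `ρ ⊊ ν`. -/
theorem HH'_orthogonality (n : ℕ) (hn : 1 ≤ n) (rho nu : YoungDiagram)
    (hrho : rho.colLen 0 ≤ n) (hnu : nu.colLen 0 ≤ n) (hsub : rho ≤ nu) (hne : rho ≠ nu) :
    ∑ᶠ sigma ∈ {sigma : YoungDiagram | rho ≤ sigma ∧ sigma ≤ nu},
      H' n aK rho sigma * H n aK sigma nu = 0 := by
  classical
  have hfin : {s : YoungDiagram | rho ≤ s ∧ s ≤ nu}.Finite :=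
    (finite_Iic nu).subset (fun s hs => hs.2)
  set F := hfin.toFinset with hFdef
  have hF : ∀ s, s ∈ F ↔ rho ≤ s ∧ s ≤ nu := by intro s; simp [hFdef]
  rw [← hfin.coe_toFinset, finsum_mem_coe_finset]
  change ∑ s ∈ F, _ = 0
  set x := aNorm n aK with hx
  have r1 : ∀ s ∈ F, (x rho - x s) * H' n aK rho s =
      ∑ t ∈ F.filter (fun t => Covers t s), H' n aK rho t := by
    intro s hs
    rw [hF] at hs
    by_cases he : rho = s
    · subst he
      rw [Finset.sum_eq_zero]
      · simp
      · intro t ht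
        rw [Finset.mem_filter, hF] at ht
        have h1 := Finset.card_le_card (YoungDiagram.cells_subset_iff.2 ht.1.1)
        have h2 := ht.2.2
        simp only [YoungDiagram.card] at h2
        omega
    · have hn0 : x rho - x s ≠ 0 :=
        sub_ne_zero.2 (aNorm_ne n ((colLen_le hs.2).trans hnu) hs.1 he)
      have := sum_snoc (fun t => (x rho - x t)⁻¹) he F
        (fun t ht h => (hF t).2 ⟨h, ht.1.trans hs.2⟩)
      change H' n aK rho s = _ * ∑ t ∈ F.filter (fun t => Covers t s), H' n aK rho t at this
      rw [this, mul_inv_cancel_left₀ hn0]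
  have r2 : ∀ s ∈ F, (x nu - x s) * H n aK s nu =
      ∑ t ∈ F.filter (Covers s), H n aK t nu := by
    intro s hs
    rw [hF] at hs
    by_cases he : s = nu
    · subst he
      rw [Finset.sum_eq_zero]
      · simp
      · intro t ht
        rw [Finset.mem_filter, hF] at ht
        have h1 := Finset.card_le_card (YoungDiagram.cells_subset_iff.2 ht.1.2)
        have h2 := ht.2.2
        simp only [YoungDiagram.card] at h2
        omega
    · have hn0 : x nu - x s ≠ 0 :=
        sub_ne_zero.2 (aNorm_ne n hnu hs.2 he).symm
      have := sum_cons (fun t => (x nu - x t)⁻¹) he F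
        (fun t ht h => (hF t).2 ⟨hs.1.trans ht.1, h⟩)
      change H n aK s nu = _ * ∑ t ∈ F.filter (Covers s), H n aK t nu at this
      rw [this, mul_inv_cancel_left₀ hn0]
  have e1 : (∑ s ∈ F, (x rho - x s) * (H' n aK rho s * H n aK s nu)) =
      ∑ s ∈ F, (x nu - x s) * (H' n aK rho s * H n aK s nu) := by
    calc _ = ∑ s ∈ F, ∑ t ∈ F, if Covers t s then H' n aK rho t * H n aK s nu else 0 := by
          refine Finset.sum_congr rfl (fun s hs => ?_)
          rw [← mul_assoc, r1 s hs, Finset.sum_mul, Finset.sum_filter]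
      _ = ∑ t ∈ F, ∑ s ∈ F, if Covers t s then H' n aK rho t * H n aK s nu else 0 :=
          Finset.sum_comm
      _ = _ := by
          refine Finset.sum_congr rfl (fun s hs => ?_)
          rw [mul_left_comm, r2 s hs, Finset.mul_sum, Finset.sum_filter]
  have e2 : (x rho - x nu) * ∑ s ∈ F, H' n aK rho s * H n aK s nu = 0 := by
    rw [Finset.mul_sum, ← sub_eq_zero.2 e1, ← Finset.sum_sub_distrib]
    exact Finset.sum_congr rfl (fun s _ => by ring)
  exact (mul_eq_zero.1 e2).resolve_left (sub_ne_zero.2 (aNorm_ne n hnu hsub hne))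

end FactorialLR
end
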